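/- Every d-degenerate finite graph G is weighted 2^{−(d+1)}-flexibly (d+2)-choosable: for every assignment of lists L(v) of size d+2 to the vertices, there is a probability distribution on proper L-colourings c such that for every vertex v and every colour x ∈ L(v), the probability that c(v) = x is at least (1/2)^{d+1}. -/

import Mathlib

/-- The expectation of `f` over the first `n` steps of the random process in which, after the
history `h` (in chronological order), the next value is `a ∈ C` with probability `κ h a`. -/
def historyExpect (C : Finset ℕ) : ℕ → (List ℕ → ℕ → ℝ) → (List ℕ → ℝ) → ℝ
  | 0, _, f => f []
  | n + 1, κ, f => ∑ a ∈ C, κ [] a * historyExpect C n (fun h => κ (a :: h)) (fun h => f (a :: h))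

/-- A probability vector on `C` all of whose entries are at most `1 / 2`. -/
structure IsSpread (C : Finset ℕ) (q : ℕ → ℝ) : Prop where
  nonneg : ∀ a, 0 ≤ q a
  le_half : ∀ a, q a ≤ 1 / 2
  sum_eq : ∑ a ∈ C, q a = 1

lemma historyExpect_congr {C : Finset ℕ} {n : ℕ} {κ κ' : List ℕ → ℕ → ℝ} {f g : List ℕ → ℝ}
    (hκ : ∀ h, h.length < n → κ h = κ' h)
    (hfg : ∀ h, h.length = n → (∀ i < n, κ (h.take i) (h.getD i 0) ≠ 0 ∧ h.getD i 0 ∈ C) →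
      f h = g h) :
    historyExpect C n κ f = historyExpect C n κ' g := by
  induction n generalizing κ κ' f g with
  | zero => exact hfg [] rfl (by simp)
  | succ n ih =>
    refine Finset.sum_congr rfl fun a ha => ?_
    rw [← hκ [] (by simp)]
    by_cases h0 : κ [] a = 0
    · simp [h0]
    congr 1
    refine ih (fun h hh => hκ _ (by simpa using hh)) fun h hh hs => hfg _ (by simpa using hh) ?_
    rintro (_ | i) hi
    · exact ⟨h0, ha⟩
    · simpa using hs i (by omega)

lemma historyExpect_sum_mul {ι : Type*} (C : Finset ℕ) (n : ℕ) (κ : List ℕ → ℕ → ℝ)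
    (s : Finset ι) (b : ι → ℝ) (f : ι → List ℕ → ℝ) :
    historyExpect C n κ (fun h => ∑ y ∈ s, b y * f y h)
      = ∑ y ∈ s, b y * historyExpect C n κ (f y) := by
  induction n generalizing κ f with
  | zero => rfl
  | succ n ih =>
    simp only [historyExpect, ih, Finset.mul_sum]
    rw [Finset.sum_comm]
    exact Finset.sum_congr rfl fun _ _ => Finset.sum_congr rfl fun _ _ => by ring

lemma historyExpect_nonneg {C : Finset ℕ} {n : ℕ} {κ : List ℕ → ℕ → ℝ} {f : List ℕ → ℝ}
    (hκ : ∀ h, IsSpread C (κ h)) (hf : ∀ h, h.length = n → 0 ≤ f h) :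
    0 ≤ historyExpect C n κ f := by
  induction n generalizing κ f with
  | zero => exact hf [] rfl
  | succ n ih =>
    exact Finset.sum_nonneg fun a _ => mul_nonneg ((hκ []).nonneg a)
      (ih (fun h => hκ _) fun h hh => hf _ (by simpa using hh))

lemma historyExpect_const {C : Finset ℕ} {n : ℕ} {κ : List ℕ → ℕ → ℝ}
    (hκ : ∀ h, IsSpread C (κ h)) (r : ℝ) : historyExpect C n κ (fun _ => r) = r := by
  induction n generalizing κ with
  | zero => rfl
  | succ n ih =>
    simp only [historyExpect]
    rw [Finset.sum_congr rfl fun a _ => by rw [ih fun h => hκ (a :: h)], ← Finset.sum_mul,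
      (hκ []).sum_eq, one_mul]

lemma historyExpect_getD_eq {C : Finset ℕ} {n i : ℕ} {κ : List ℕ → ℕ → ℝ}
    (hκ : ∀ h, IsSpread C (κ h)) (hi : i < n) {x : ℕ} (hx : x ∈ C) :
    historyExpect C n κ (fun h => if h.getD i 0 = x then 1 else 0)
      = historyExpect C i κ (fun h => κ h x) := by
  induction n generalizing κ i with
  | zero => omega
  | succ n ih =>
    cases i with
    | zero =>
      simp only [historyExpect, List.getD_cons_zero]
      rw [Finset.sum_congr rfl fun a _ => by rw [historyExpect_const fun h => hκ (a :: h)]]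
      simp [hx]
    | succ i =>
      simp only [historyExpect, List.getD_cons_succ]
      exact Finset.sum_congr rfl fun a _ => by rw [ih (fun h => hκ (a :: h)) (by omega)]

lemma IsSpread.uniform {C R : Finset ℕ} (hRC : R ⊆ C) (hR : 2 ≤ R.card) :
    IsSpread C (fun x => if x ∈ R then (R.card : ℝ)⁻¹ else 0) where
  nonneg a := by positivity
  le_half a := by
    have : (2 : ℝ) ≤ R.card := by exact_mod_cast hR
    split_ifs
    · rw [one_div]; gcongr
    · norm_num
  sum_eq := by
    have : (R.card : ℝ) ≠ 0 := by positivity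
    rw [← Finset.sum_filter, Finset.filter_mem_eq_inter, Finset.inter_eq_right.2 hRC]
    simp [this]

/-- A spread vector can be averaged, so that mass outside `R` is moved into `R`, keeping it
spread. -/
lemma IsSpread.exists_redirect {C R : Finset ℕ} {q : ℕ → ℝ} (hq : IsSpread C q) (hRC : R ⊆ C)
    (hR : 3 ≤ R.card) :
    ∃ D : ℕ → ℕ → ℝ, (∀ a, ∀ y ∈ R, 0 ≤ D a y) ∧ (∀ a, ∑ y ∈ R, D a y = 1) ∧
      (∀ a ∈ R, ∀ y, y ≠ a → D a y = 0) ∧ ∀ y ∈ R, ∑ a ∈ C, q a * D a y ≤ 1 / 2 := by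
  have hR' : (3 : ℝ) ≤ R.card := by exact_mod_cast hR
  have hle : ∑ y ∈ R, q y ≤ 1 :=
    hq.sum_eq ▸ Finset.sum_le_sum_of_subset_of_nonneg hRC fun a _ _ => hq.nonneg a
  set Q := ∑ y ∈ R, q y with hQ
  have hpos : 0 < (R.card : ℝ) / 2 - Q := by linarith
  refine ⟨fun a y => if a ∈ R then (if y = a then 1 else 0) else
    (1 / 2 - q y) / ((R.card : ℝ) / 2 - Q), fun a y _ => ?_, fun a => ?_, fun a ha y hy => ?_,
    fun y hy => ?_⟩
  · have := hq.le_half y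
    dsimp only
    split_ifs
    · exact zero_le_one
    · exact le_rfl
    · exact div_nonneg (by linarith) hpos.le
  · by_cases ha : a ∈ R
    · simp [ha]
    · simp only [ha, if_false]
      rw [← Finset.sum_div, Finset.sum_sub_distrib, ← hQ, div_eq_one_iff_eq hpos.ne']
      simp [div_eq_mul_inv]
  · simp [ha, hy]
  · have hout : ∑ a ∈ C \ R, q a = 1 - Q := by
      rw [← hq.sum_eq, ← Finset.sum_sdiff hRC]; ring
    have hin : ∑ a ∈ R, q a * (if a ∈ R then (if y = a then 1 else 0) else
        (1 / 2 - q y) / ((R.card : ℝ) / 2 - Q)) = q y := by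
      rw [Finset.sum_congr rfl fun a ha => by rw [if_pos ha]]
      simp [hy]
    dsimp only
    rw [← Finset.sum_sdiff hRC, hin, Finset.sum_congr rfl fun a ha => by
      rw [if_neg (Finset.mem_sdiff.1 ha).2], ← Finset.sum_mul, hout]
    have h1 : (1 - Q) * ((1 / 2 - q y) / ((R.card : ℝ) / 2 - Q)) ≤ 1 / 2 - q y := by
      rw [← mul_div_assoc, div_le_iff₀ hpos, mul_comm]
      have := hq.le_half y
      exact mul_le_mul_of_nonneg_left (by linarith) (by linarith)
    linarith

/-- A vertex with list `R` of size `m + 2` and at most `m` coloured neighbours, marked by `N`, can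
be coloured by a spread vector that depends on the history, avoids the colours of its neighbours
and gives each colour of `R` probability at least `(1 / 2) ^ (m + 1)`. -/
lemma exists_spread_extension {C : Finset ℕ} (N : List Bool) (κ : List ℕ → ℕ → ℝ)
    (hκ : ∀ h, IsSpread C (κ h)) (m : ℕ) (R : Finset ℕ) (hRC : R ⊆ C) (hR : R.card = m + 2)
    (hN : N.count true ≤ m) :
    ∃ p : List ℕ → ℕ → ℝ, (∀ h, h.length = N.length → IsSpread C (p h)) ∧
      (∀ h, ∀ x ∉ R, h.length = N.length → p h x = 0) ∧
      (∀ h j, h.length = N.length → N.getD j false = true → p h (h.getD j 0) = 0) ∧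
      ∀ x ∈ R, (1 / 2 : ℝ) ^ (m + 1) ≤ historyExpect C N.length κ (fun h => p h x) := by
  induction N generalizing κ m R with
  | nil =>
    refine ⟨fun _ x => if x ∈ R then (R.card : ℝ)⁻¹ else 0,
      fun _ _ => IsSpread.uniform hRC (by omega), fun h x hx _ => by simp [hx], by simp, ?_⟩
    intro x hx
    simp only [List.length_nil, historyExpect, hx, if_true, hR]
    rw [one_div, inv_pow]
    have : m + 2 ≤ 2 ^ (m + 1) := Nat.lt_two_pow_self (n := m + 1)
    gcongr
    exact_mod_cast this
  | cons b N ih =>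
    cases b with
    | false =>
      choose P hP hP0 hPN hPE using fun a => ih (fun h => κ (a :: h)) (fun h => hκ _) m R hRC hR
        (by simpa using hN)
      refine ⟨fun h => P (h.headD 0) h.tail, fun h hh => hP _ _ (by simp [hh]),
        fun h x hx hh => hP0 _ _ x hx (by simp [hh]), ?_, fun x hx => ?_⟩
      · rintro (_ | ⟨a, h⟩) (_ | j) hh hj
        · simp at hh
        · simp at hh
        · simp at hj
        · simpa using hPN a h j (by simpa using hh) (by simpa using hj)
      · simp only [List.length_cons, historyExpect, List.headD_cons, List.tail_cons]
        calc (1 / 2 : ℝ) ^ (m + 1) = ∑ a ∈ C, κ [] a * (1 / 2 : ℝ) ^ (m + 1) := by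
              rw [← Finset.sum_mul, (hκ []).sum_eq, one_mul]
          _ ≤ _ := Finset.sum_le_sum fun a _ =>
              mul_le_mul_of_nonneg_left (hPE a x hx) ((hκ []).nonneg a)
    | true =>
      obtain ⟨m, rfl⟩ : ∃ k, m = k + 1 := ⟨m - 1, by simp at hN; omega⟩
      obtain ⟨D, hD0, hD1, hDR, hDq⟩ := (hκ []).exists_redirect hRC (by omega)
      have key : ∀ (a : ℕ) (y : R), _ := fun a y => ih (fun h => κ (a :: h)) (fun h => hκ _) m
        (R.erase y) ((Finset.erase_subset _ _).trans hRC)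
        (by rw [Finset.card_erase_of_mem y.2, hR]; rfl) (by simpa using hN)
      choose P' hP' hP0' hPN' hPE' using key
      obtain ⟨P, hPdef⟩ : ∃ P : ℕ → ℕ → List ℕ → ℕ → ℝ, ∀ a (y : R), P a y = P' a y :=
        ⟨fun a y => if hy : y ∈ R then P' a ⟨y, hy⟩ else 0, fun a y => by simp⟩
      have hP : ∀ a, ∀ y ∈ R, ∀ h, h.length = N.length → IsSpread C (P a y h) :=
        fun a y hy h => by rw [hPdef a ⟨y, hy⟩]; exact hP' a ⟨y, hy⟩ h
      have hP0 : ∀ a, ∀ y ∈ R, ∀ h, ∀ x ∉ R.erase y, h.length = N.length → P a y h x = 0 :=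
        fun a y hy h => by rw [hPdef a ⟨y, hy⟩]; exact hP0' a ⟨y, hy⟩ h
      have hPN : ∀ a, ∀ y ∈ R, ∀ h j, h.length = N.length → N.getD j false = true →
          P a y h (h.getD j 0) = 0 :=
        fun a y hy h => by rw [hPdef a ⟨y, hy⟩]; exact hPN' a ⟨y, hy⟩ h
      have hPE : ∀ a, ∀ y ∈ R, ∀ x ∈ R.erase y, (1 / 2 : ℝ) ^ (m + 1) ≤
          historyExpect C N.length (fun h => κ (a :: h)) (fun h => P a y h x) :=
        fun a y hy => by rw [hPdef a ⟨y, hy⟩]; exact hPE' a ⟨y, hy⟩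
      clear hPdef hP' hP0' hPN' hPE'
      refine ⟨fun h x => ∑ y ∈ R, D (h.headD 0) y * P (h.headD 0) y h.tail x, fun h hh => ?_,
        fun h x hx hh => ?_, ?_, fun x hx => ?_⟩
      · have hh' : h.tail.length = N.length := by simp [hh]
        refine ⟨fun x => Finset.sum_nonneg fun y hy => mul_nonneg (hD0 _ y hy)
          ((hP _ y hy _ hh').nonneg x), fun x => ?_, ?_⟩
        · calc _ ≤ ∑ y ∈ R, D (h.headD 0) y * (1 / 2) := Finset.sum_le_sum fun y hy =>
                mul_le_mul_of_nonneg_left ((hP _ y hy _ hh').le_half x) (hD0 _ y hy)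
            _ = 1 / 2 := by rw [← Finset.sum_mul, hD1, one_mul]
        · rw [Finset.sum_comm, ← hD1 (h.headD 0)]
          exact Finset.sum_congr rfl fun y hy => by
            rw [← Finset.mul_sum, (hP _ y hy _ hh').sum_eq, mul_one]
      · exact Finset.sum_eq_zero fun y hy => by
          rw [hP0 _ y hy _ x (fun hx' => hx (Finset.mem_of_mem_erase hx')) (by simp [hh]), mul_zero]
      · rintro (_ | ⟨a, h⟩) (_ | j) hh hj
        · simp at hh
        · simp at hh
        · refine Finset.sum_eq_zero fun y hy => ?_
          simp only [List.headD_cons, List.tail_cons, List.getD_cons_zero]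
          by_cases hya : y = a
          · subst hya
            rw [hP0 _ y hy _ y (Finset.notMem_erase y R) (by simpa using hh), mul_zero]
          by_cases ha : a ∈ R
          · rw [hDR a ha y hya, zero_mul]
          · rw [hP0 _ y hy _ a (fun h' => ha (Finset.mem_of_mem_erase h')) (by simpa using hh),
              mul_zero]
        · refine Finset.sum_eq_zero fun y hy => ?_
          simp only [List.headD_cons, List.tail_cons, List.getD_cons_succ]
          rw [hPN a y hy h j (by simpa using hh) (by simpa using hj), mul_zero]
      · simp only [List.length_cons, historyExpect, List.headD_cons, List.tail_cons,
          historyExpect_sum_mul]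
        calc (1 / 2 : ℝ) ^ (m + 1 + 1)
            ≤ (1 - ∑ a ∈ C, κ [] a * D a x) * (1 / 2 : ℝ) ^ (m + 1) := by
              rw [pow_succ' _ (m + 1)]
              gcongr
              linarith [hDq x hx]
          _ = ∑ a ∈ C, κ [] a * ∑ y ∈ R.erase x, D a y * (1 / 2 : ℝ) ^ (m + 1) := by
              rw [← (hκ []).sum_eq, ← Finset.sum_sub_distrib, Finset.sum_mul]
              refine Finset.sum_congr rfl fun a _ => ?_
              rw [← Finset.sum_mul, Finset.sum_erase_eq_sub hx, hD1]
              ring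
          _ ≤ _ := by
              refine Finset.sum_le_sum fun a _ =>
                mul_le_mul_of_nonneg_left ?_ ((hκ []).nonneg a)
              have hnn : 0 ≤ D a x * historyExpect C N.length (fun h => κ (a :: h))
                  (fun h => P a x h x) := by
                refine mul_nonneg (hD0 a x hx) (historyExpect_nonneg (fun h => hκ _) fun h hh => ?_)
                exact (hP a x hx h hh).nonneg x
              rw [← Finset.add_sum_erase R _ hx]
              refine le_add_of_nonneg_of_le hnn (Finset.sum_le_sum fun y hy => ?_)
              obtain ⟨hyx, hyR⟩ := Finset.mem_erase.1 hy
              exact mul_le_mul_of_nonneg_left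
                (hPE a y hyR x (Finset.mem_erase.2 ⟨hyx.symm, hx⟩)) (hD0 a y hyR)

lemma exists_spread_process {C : Finset ℕ} (d : ℕ) (R : ℕ → Finset ℕ) (N : ℕ → List Bool)
    (hRC : ∀ t, R t ⊆ C) (hR : ∀ t, (R t).card = d + 2) (hNl : ∀ t, (N t).length = t)
    (hN : ∀ t, (N t).count true ≤ d) (n : ℕ) :
    ∃ κ : List ℕ → ℕ → ℝ, (∀ h, IsSpread C (κ h)) ∧
      ∀ t < n, (∀ h, ∀ x ∉ R t, h.length = t → κ h x = 0) ∧
        (∀ h j, h.length = t → (N t).getD j false = true → κ h (h.getD j 0) = 0) ∧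
        ∀ x ∈ R t, (1 / 2 : ℝ) ^ (d + 1) ≤ historyExpect C t κ (fun h => κ h x) := by
  induction n with
  | zero => exact ⟨_, fun _ => IsSpread.uniform (hRC 0) (by rw [hR]; omega), by simp⟩
  | succ n ih =>
    obtain ⟨κ, hκ, hstep⟩ := ih
    obtain ⟨p, hp, hp0, hpN, hpE⟩ :=
      exists_spread_extension (N n) κ hκ d (R n) (hRC n) (hR n) (hN n)
    rw [hNl] at hp hp0 hpN hpE
    refine ⟨fun h => if h.length = n then p h else κ h, fun h => ?_, fun t ht => ?_⟩
    · dsimp only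
      split_ifs with hh
      · exact hp h hh
      · exact hκ h
    · obtain rfl | ht := Nat.lt_succ_iff_lt_or_eq.1 ht |>.symm
      · refine ⟨fun h x hx hh => by simpa [hh] using hp0 h x hx hh,
          fun h j hh hj => by simpa [hh] using hpN h j hh hj, fun x hx => (hpE x hx).trans_eq ?_⟩
        exact historyExpect_congr (fun h hh => by simp [hh.ne]) fun h hh _ => by simp [hh]
      · obtain ⟨h1, h2, h3⟩ := hstep t ht
        refine ⟨fun h x hx hh => ?_, fun h j hh hj => ?_, fun x hx => (h3 x hx).trans_eq ?_⟩
        · have : h.length ≠ n := by omega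
          simpa [this] using h1 h x hx hh
        · have : h.length ≠ n := by omega
          simpa [this] using h2 h j hh hj
        · refine historyExpect_congr (fun h hh => ?_) fun h hh _ => ?_
          · have : h.length ≠ n := by omega
            simp [this]
          · have : h.length ≠ n := by omega
            simp [this]

/-- Every d-degenerate graph is weighted 2^{-(d+1)}-flexibly (d+2)-choosable. -/
theorem stmt_6 {V : Type*} [Fintype V] [DecidableEq V]
    (G : SimpleGraph V) [DecidableRel G.Adj] (d : ℕ)
    (hdeg : ∃ f : V → ℕ, Function.Injective f ∧
      ∀ v, (Finset.univ.filter (fun u => G.Adj v u ∧ f v < f u)).card ≤ d)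
    (L : V → Finset ℕ) (hL : ∀ v, (L v).card = d + 2) :
    ∃ (S : Finset (V → ℕ)) (w : (V → ℕ) → ℝ),
      (∀ c ∈ S, (∀ v, c v ∈ L v) ∧ ∀ u v, G.Adj u v → c u ≠ c v) ∧
      (∀ c ∈ S, 0 ≤ w c) ∧ (∑ c ∈ S, w c = 1) ∧
      (∀ v, ∀ x ∈ L v, ((1 : ℝ)/2) ^ (d + 1) ≤ ∑ c ∈ S.filter (fun c => c v = x), w c) := by
  classical
  obtain ⟨f, hf, hfd⟩ := hdeg
  set M := Finset.univ.sup f with hM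
  have hfM : ∀ v, f v ≤ M := fun v => Finset.le_sup (Finset.mem_univ v)
  -- Vertices are coloured in decreasing order of `f`; times that belong to no vertex are dummies.
  set τ : V → ℕ := fun v => M - f v with hτ
  have hτlt : ∀ v, τ v < M + 1 := fun v => by simp only [hτ]; omega
  have hτf : ∀ u v, τ u < τ v ↔ f v < f u := fun u v => by
    have := hfM u; have := hfM v; simp only [hτ]; omega
  have hτi : Function.Injective τ := fun u v h => hf (by
    have := hfM u; have := hfM v; simp only [hτ] at h; omega)
  set C : Finset ℕ := Finset.univ.biUnion L ∪ Finset.range (d + 2) with hC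
  obtain ⟨R, hRL, hRC, hRcard⟩ : ∃ R : ℕ → Finset ℕ, (∀ v, R (τ v) = L v) ∧ (∀ t, R t ⊆ C) ∧
      ∀ t, (R t).card = d + 2 := by
    have hLC : ∀ v, L v ⊆ C := fun v =>
      (Finset.subset_biUnion_of_mem L (Finset.mem_univ v)).trans Finset.subset_union_left
    refine ⟨Function.extend τ L fun _ => Finset.range (d + 2), fun v => hτi.extend_apply _ _ v,
      fun t => ?_, fun t => ?_⟩
    all_goals by_cases ht : ∃ v, τ v = t
    · obtain ⟨v, rfl⟩ := ht
      rw [hτi.extend_apply]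
      exact hLC v
    · rw [Function.extend_apply' _ _ _ ht]
      exact Finset.subset_union_right
    · obtain ⟨v, rfl⟩ := ht
      rw [hτi.extend_apply, hL]
    · rw [Function.extend_apply' _ _ _ ht, Finset.card_range]
  set N : ℕ → List Bool := fun t =>
    (List.range t).map fun s => decide (∃ u v, τ u = s ∧ τ v = t ∧ G.Adj v u) with hN
  have hNcount : ∀ t, (N t).count true ≤ d := by
    intro t
    have hcount : (N t).count true
        = ((Finset.range t).filter fun s => ∃ u v, τ u = s ∧ τ v = t ∧ G.Adj v u).card := by
      rw [hN, List.count, List.countP_map, List.countP_eq_length_filter]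
      change _ = (List.filter _ (List.range t)).length
      congr 2
      ext s
      simp
    rw [hcount]
    by_cases ht : ∃ v, τ v = t
    · obtain ⟨v, rfl⟩ := ht
      refine le_trans ?_ (hfd v)
      refine (Finset.card_le_card (t := Finset.image τ _) ?_).trans Finset.card_image_le
      intro s hs
      obtain ⟨hs, u, v', rfl, hv', huv⟩ := Finset.mem_filter.1 hs
      obtain rfl := hτi hv'
      simp only [Finset.mem_image, Finset.mem_filter, Finset.mem_univ, true_and]
      exact ⟨u, ⟨huv, (hτf _ _).1 (Finset.mem_range.1 hs)⟩, rfl⟩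
    · rw [Finset.filter_false_of_mem]
      · simp
      · rintro s - ⟨u, v, -, hv, -⟩
        exact ht ⟨v, hv⟩
  obtain ⟨κ, hκ, hstep⟩ := exists_spread_process d R N hRC hRcard (fun t => by simp [hN]) hNcount
    (M + 1)
  set S : Finset (V → ℕ) :=
    (Fintype.piFinset L).filter fun c => ∀ u v, G.Adj u v → c u ≠ c v with hS
  have hsupp : ∀ h : List ℕ, h.length = M + 1 →
      (∀ i < M + 1, κ (h.take i) (h.getD i 0) ≠ 0 ∧ h.getD i 0 ∈ C) →
      (fun v => h.getD (τ v) 0) ∈ S := by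
    intro h hh hpos
    have hlen : ∀ v, (h.take (τ v)).length = τ v := fun v => by
      have := hτlt v
      rw [List.length_take]; omega
    have hlt : ∀ u v, τ u < τ v → G.Adj v u → h.getD (τ u) 0 ≠ h.getD (τ v) 0 := by
      intro u v huv hadj heq
      refine (hpos _ (hτlt v)).1 ?_
      have := (hstep _ (hτlt v)).2.1 (h.take (τ v)) (τ u) (hlen v) (by
        simp only [hN, List.getD_eq_getElem?_getD, List.getElem?_map, List.getElem?_range huv,
          Option.map_some, Option.getD_some, decide_eq_true_eq]
        exact ⟨u, v, rfl, rfl, hadj⟩)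
      rwa [show (h.take (τ v)).getD (τ u) 0 = h.getD (τ u) 0 by
        simp [List.getD_eq_getElem?_getD, huv], heq] at this
    simp only [hS, Finset.mem_filter, Fintype.mem_piFinset]
    refine ⟨fun v => ?_, fun u v huv => ?_⟩
    · by_contra hv
      rw [← hRL] at hv
      exact (hpos _ (hτlt v)).1 ((hstep _ (hτlt v)).1 _ _ hv (hlen v))
    · obtain h1 | h1 := lt_or_gt_of_ne (hτi.ne huv.ne)
      · exact hlt u v h1 huv.symm
      · exact (hlt v u h1 huv).symm
  set w : (V → ℕ) → ℝ := fun c => historyExpect C (M + 1) κ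
    (fun h => if (fun v => h.getD (τ v) 0) = c then 1 else 0) with hw
  have hsum : ∀ T : Finset (V → ℕ), ∑ c ∈ T, w c = historyExpect C (M + 1) κ
      (fun h => if (fun v => h.getD (τ v) 0) ∈ T then 1 else 0) := by
    intro T
    have := historyExpect_sum_mul C (M + 1) κ T (fun _ => 1)
      (fun c h => if (fun v => h.getD (τ v) 0) = c then 1 else 0)
    simp only [one_mul, Finset.sum_ite_eq] at this
    exact this.symm
  refine ⟨S, w, fun c hc => ?_, fun c _ => ?_, ?_, fun v x hx => ?_⟩
  · simpa [hS] using hc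
  · exact historyExpect_nonneg hκ fun h _ => by positivity
  · rw [hsum]
    refine Eq.trans ?_ (historyExpect_const (n := M + 1) hκ 1)
    exact historyExpect_congr (fun _ _ => rfl) fun h hh hp => if_pos (hsupp h hh hp)
  · rw [← hRL] at hx
    refine ((hstep _ (hτlt v)).2.2 x hx).trans_eq ?_
    rw [hsum, ← historyExpect_getD_eq hκ (hτlt v) (hRC _ hx)]
    refine historyExpect_congr (fun _ _ => rfl) fun h hh hp => ?_
    simp only [Finset.mem_filter, hsupp h hh hp, true_and]
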